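/- arXiv:math/0610904 — 7 statements merged into one kernel-verified Lean document; each statement's English description precedes it below -/
import Mathlib

section
/- Let a, b ≥ 1 be integers and suppose f : ℝ → ℝ is twice differentiable, satisfies the differential equation f''(α) + (a+b)·tanh(α)·f'(α) + a·b·f(α) = 0 for all α ∈ ℝ, and satisfies f'(0) = 0 and f(0) ≠ 0. Then |f(α)| < |f(0)| for every α ≠ 0. -/
open Real

lemma damped_oscillator_abs_lt_of_pos {c k : ℝ} (hc : 0 < c) (hk : 0 < k) {f f' f'' : ℝ → ℝ}
    (hf : ∀ α, HasDerivAt f (f' α) α) (hf' : ∀ α, HasDerivAt f' (f'' α) α)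
    (hode : ∀ α, f'' α + c * Real.tanh α * f' α + k * f α = 0)
    (h0 : f' 0 = 0) (hne : f 0 ≠ 0) {x : ℝ} (hx : 0 < x) : |f x| < |f 0| := by
  have tanh_pos : ∀ y : ℝ, 0 < y → 0 < Real.tanh y := fun y hy => by
    rw [Real.tanh_eq_sinh_div_cosh]
    exact div_pos (Real.sinh_pos_iff.2 hy) (Real.cosh_pos y)
  set E : ℝ → ℝ := fun y => f' y ^ 2 + k * f y ^ 2 with hE
  have hdE : ∀ y, HasDerivAt E (-(2 * c * Real.tanh y * f' y ^ 2)) y := fun y => by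
    refine (((hf' y).pow 2).add (((hf y).pow 2).const_mul k)).congr_deriv ?_
    linear_combination 2 * f' y * hode y
  have hanti : AntitoneOn E (Set.Ici 0) := by
    refine antitoneOn_of_deriv_nonpos (convex_Ici 0)
      (fun y _ => (hdE y).continuousAt.continuousWithinAt)
      (fun y _ => (hdE y).differentiableAt.differentiableWithinAt) fun y hy => ?_
    rw [interior_Ici, Set.mem_Ioi] at hy
    have := tanh_pos y hy
    rw [(hdE y).deriv, neg_nonpos]
    positivity
  have hlt : E x < E 0 := by
    by_contra! hle
    have hconst : ∀ y ∈ Set.Ioo 0 x, E y = E 0 := fun y hy =>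
      le_antisymm (hanti Set.self_mem_Ici hy.1.le hy.1.le)
        (hle.trans (hanti hy.1.le hx.le hy.2.le))
    have hf'_zero : ∀ y ∈ Set.Ioo 0 x, f' y = 0 := fun y hy => by
      have heq : E =ᶠ[nhds y] fun _ => E 0 :=
        Filter.eventually_of_mem (isOpen_Ioo.mem_nhds hy) hconst
      have h := (hdE y).unique ((hasDerivAt_const y (E 0)).congr_of_eventuallyEq heq)
      have := tanh_pos y hy.1
      simpa [hc.ne', this.ne'] using h
    have hy : x / 2 ∈ Set.Ioo 0 x := ⟨by linarith, by linarith⟩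
    have heq : f' =ᶠ[nhds (x / 2)] fun _ => 0 :=
      Filter.eventually_of_mem (isOpen_Ioo.mem_nhds hy) hf'_zero
    have hf''_zero := (hf' (x / 2)).unique ((hasDerivAt_const _ 0).congr_of_eventuallyEq heq)
    have hf_zero : f (x / 2) = 0 := by
      simpa [hf''_zero, hf'_zero _ hy, hk.ne'] using hode (x / 2)
    have h := hconst _ hy
    simp [hE, hf_zero, hf'_zero _ hy, h0, hk.ne', hne] at h
  simp only [hE, h0] at hlt
  refine sq_lt_sq.1 (lt_of_mul_lt_mul_left ?_ hk.le)
  nlinarith [sq_nonneg (f' x)]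

/-- If `f` solves the damped oscillator equation
`f'' + (a+b)·tanh(α)·f' + ab·f = 0` with `f'(0) = 0` and `f(0) ≠ 0`,
then `|f(α)| < |f(0)|` for all `α ≠ 0`. -/
theorem damped_oscillator_strict_max (a b : ℕ) (ha : 1 ≤ a) (hb : 1 ≤ b)
    (f f' f'' : ℝ → ℝ)
    (hf : ∀ α, HasDerivAt f (f' α) α)
    (hf' : ∀ α, HasDerivAt f' (f'' α) α)
    (hode : ∀ α, f'' α + (a + b : ℝ) * Real.tanh α * f' α + (a * b : ℝ) * f α = 0)
    (h0 : f' 0 = 0) (hne : f 0 ≠ 0) :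
    ∀ α : ℝ, α ≠ 0 → |f α| < |f 0| := by
  have hc : (0 : ℝ) < a + b := by positivity
  have hk : (0 : ℝ) < a * b := by positivity
  intro α hα
  rcases hα.lt_or_gt with hneg | hpos
  · have hg (y : ℝ) : HasDerivAt (fun z => f (-z)) (-f' (-y)) y := by
      exact ((hf (-y)).comp y (hasDerivAt_neg y)).congr_deriv (by ring)
    have hg' (y : ℝ) : HasDerivAt (fun z => -f' (-z)) (f'' (-y)) y := by
      exact ((hf' (-y)).comp y (hasDerivAt_neg y)).neg.congr_deriv (by ring)
    have h := damped_oscillator_abs_lt_of_pos hc hk hg hg'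
      (fun y => by
        have h := hode (-y)
        rw [Real.tanh_neg] at h
        linear_combination h)
      (by simpa using h0) (by simpa using hne) (neg_pos.2 hneg)
    simpa using h
  · exact damped_oscillator_abs_lt_of_pos hc hk hf hf' hode h0 hne hpos
end

section
/- The function f(α) = (sinh(α) − α·cosh(α))/sinh(α)^3 satisfies f''(α) + 4·coth(α)·f'(α) + 4·f(α) = 0 for all α ∈ (0,∞). -/
open Real

/-- The first derivative, simplified with `cosh² = 1 + sinh²`. -/
theorem hasDerivAt_sinh_sub_mul_cosh_div_sinh_pow_three {x : ℝ} (hx : x ≠ 0) :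
    HasDerivAt (fun β => (Real.sinh β - β * Real.cosh β) / (Real.sinh β) ^ 3)
      ((2 * x * Real.sinh x ^ 2 + 3 * x - 3 * Real.cosh x * Real.sinh x) / Real.sinh x ^ 4) x := by
  have hs : Real.sinh x ≠ 0 := Real.sinh_ne_zero.2 hx
  have hf := ((Real.hasDerivAt_sinh x).fun_sub
    ((hasDerivAt_id' x).fun_mul (Real.hasDerivAt_cosh x))).fun_div
    ((Real.hasDerivAt_sinh x).fun_pow 3) (pow_ne_zero 3 hs)
  refine hf.congr_deriv ?_
  field_simp
  ring_nf
  simp only [Real.cosh_sq]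
  ring

/-- The second derivative, simplified with `cosh² = 1 + sinh²`. -/
theorem hasDerivAt_deriv_sinh_sub_mul_cosh_div_sinh_pow_three {x : ℝ} (hx : x ≠ 0) :
    HasDerivAt (deriv fun β => (Real.sinh β - β * Real.cosh β) / (Real.sinh β) ^ 3)
      ((8 * Real.sinh x ^ 3 + 12 * Real.sinh x - 4 * x * Real.cosh x * Real.sinh x ^ 2
        - 12 * x * Real.cosh x) / Real.sinh x ^ 5) x := by
  have hs : Real.sinh x ≠ 0 := Real.sinh_ne_zero.2 hx
  have hS := Real.hasDerivAt_sinh x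
  have hg := (((((hasDerivAt_id' x).const_mul 2).fun_mul (hS.fun_pow 2)).fun_add
    ((hasDerivAt_id' x).const_mul 3)).fun_sub
    (((Real.hasDerivAt_cosh x).const_mul 3).fun_mul hS)).fun_div
    (hS.fun_pow 4) (pow_ne_zero 4 hs)
  refine (hg.congr_deriv ?_).congr_of_eventuallyEq ?_
  · field_simp
    ring_nf
    simp only [Real.cosh_sq]
    ring
  · filter_upwards [isOpen_ne.mem_nhds hx] with y hy
    exact (hasDerivAt_sinh_sub_mul_cosh_div_sinh_pow_three hy).deriv

/-- The odd solution `f(α) = (sinh α − α·cosh α) / sinh³ α` of the linking-form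
equation `f'' + 4·coth(α)·f' + 4·f = 0` on `(0,∞)`
(with `coth α = cosh α / sinh α`). -/
theorem hyperbolic_linking_odd_solution :
    ∀ α ∈ Set.Ioi (0 : ℝ),
      deriv (deriv (fun β => (Real.sinh β - β * Real.cosh β) / (Real.sinh β) ^ 3)) α
        + 4 * (Real.cosh α / Real.sinh α) *
            deriv (fun β => (Real.sinh β - β * Real.cosh β) / (Real.sinh β) ^ 3) α
        + 4 * ((Real.sinh α - α * Real.cosh α) / (Real.sinh α) ^ 3) = 0 := by
  intro α hα
  have hα : α ≠ 0 := (Set.mem_Ioi.1 hα).ne'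
  have hs : Real.sinh α ≠ 0 := Real.sinh_ne_zero.2 hα
  rw [(hasDerivAt_deriv_sinh_sub_mul_cosh_div_sinh_pow_three hα).deriv,
    (hasDerivAt_sinh_sub_mul_cosh_div_sinh_pow_three hα).deriv]
  field_simp
  ring_nf
  simp only [Real.cosh_sq]
  ring
end

section
/- The function f(α) = ((π − α)·cos(α) + sin(α))/sin(α)^3 satisfies f''(α) + 4·cot(α)·f'(α) − 4·f(α) = 0 for all α ∈ (0,π). -/
open Real

theorem hasDerivAt_linking_kernel {x : ℝ} (hx : Real.sin x ≠ 0) :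
    HasDerivAt (fun β => ((π - β) * Real.cos β + Real.sin β) / (Real.sin β) ^ 3)
      (-(π - x) / Real.sin x ^ 2
        - 3 * Real.cos x * ((π - x) * Real.cos x + Real.sin x) / Real.sin x ^ 4) x := by
  have h := (((((hasDerivAt_id' x).const_sub π).mul (Real.hasDerivAt_cos x)).add
    (Real.hasDerivAt_sin x)).div ((Real.hasDerivAt_sin x).pow 3) (pow_ne_zero 3 hx))
  refine h.congr_deriv ?_
  simp only [Pi.mul_apply, Pi.add_apply, Pi.pow_apply]
  push_cast
  field_simp
  ring

theorem hasDerivAt_deriv_linking_kernel {x : ℝ} (hx : Real.sin x ≠ 0) :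
    HasDerivAt (fun β => -(π - β) / Real.sin β ^ 2
        - 3 * Real.cos β * ((π - β) * Real.cos β + Real.sin β) / Real.sin β ^ 4)
      (1 / Real.sin x ^ 2 + 5 * (π - x) * Real.cos x / Real.sin x ^ 3
        + 3 * ((π - x) * Real.cos x + Real.sin x) / Real.sin x ^ 3
        + 12 * Real.cos x ^ 2 * ((π - x) * Real.cos x + Real.sin x) / Real.sin x ^ 5) x := by
  have hp := (hasDerivAt_id' x).const_sub π
  have hs := Real.hasDerivAt_sin x
  have hc := Real.hasDerivAt_cos x
  have h := (hp.neg.div (hs.pow 2) (pow_ne_zero 2 hx)).sub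
    (((hc.const_mul 3).mul ((hp.mul hc).add hs)).div (hs.pow 4) (pow_ne_zero 4 hx))
  refine h.congr_deriv ?_
  simp only [Pi.mul_apply, Pi.add_apply, Pi.pow_apply, Pi.neg_apply]
  push_cast
  field_simp
  ring

open Real

/-- The solution `f(α) = ((π − α)·cos α + sin α) / sin³ α` of the spherical
linking-form equation `f'' + 4·cot(α)·f' − 4·f = 0` on `(0, π)`. -/
theorem spherical_linking_solution :
    ∀ α ∈ Set.Ioo (0 : ℝ) π,
      deriv (deriv (fun β => ((π - β) * Real.cos β + Real.sin β) / (Real.sin β) ^ 3)) α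
        + 4 * Real.cot α *
            deriv (fun β => ((π - β) * Real.cos β + Real.sin β) / (Real.sin β) ^ 3) α
        - 4 * (((π - α) * Real.cos α + Real.sin α) / (Real.sin α) ^ 3) = 0 := by
  intro α hα
  have hs : Real.sin α ≠ 0 := (Real.sin_pos_of_mem_Ioo hα).ne'
  have hev : ∀ᶠ x in nhds α, Real.sin x ≠ 0 :=
    Real.continuous_sin.continuousAt.eventually_ne hs
  rw [Filter.EventuallyEq.deriv_eq (hev.mono fun x hx => (hasDerivAt_linking_kernel hx).deriv),
    (hasDerivAt_deriv_linking_kernel hs).deriv, (hasDerivAt_linking_kernel hs).deriv,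
    Real.cot_eq_cos_div_sin]
  field_simp
  ring
end

section
/- Let n ≥ 1 and let K ⊆ ℝ^n be a compact convex set whose interior contains the origin. Then vol((K − K)°) ≤ 2^{−n}·vol(K°), where K − K = {x − y : x, y ∈ K} is the difference body; moreover equality holds if and only if K = −K. -/
open MeasureTheory Real Pointwise
open scoped RealInnerProductSpace

/-- The polar body of a set `K ⊆ ℝⁿ`. -/
noncomputable def polarBody {n : ℕ} (K : Set (EuclideanSpace ℝ (Fin n))) :
    Set (EuclideanSpace ℝ (Fin n)) :=
  {y | ∀ x ∈ K, ⟪x, y⟫ ≤ (1 : ℝ)}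

/-- If `f ≥ 0` is positively homogeneous of degree one, then `∫ exp (-f)` is a dimensional constant
times the volume of `{f ≤ 1}`. -/
lemma lintegral_exp_neg_eq_mul_volume {n : ℕ} (hn : n ≠ 0)
    {f : EuclideanSpace ℝ (Fin n) → ℝ} (hf : Continuous f) (hpos : ∀ y, 0 ≤ f y)
    (hzero : ∀ y, f y = 0 → y = 0) (hhom : ∀ c : ℝ, 0 ≤ c → ∀ y, f (c • y) = c * f y) :
    ∫⁻ y, ENNReal.ofReal (exp (-f y)) =
      (∫⁻ t in Set.Ioi (0 : ℝ), ENNReal.ofReal (-log t) ^ n) * volume {y | f y ≤ 1} := by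
  rw [lintegral_eq_lintegral_meas_le volume (.of_forall fun _ ↦ (exp_pos _).le)
    (by fun_prop : Measurable fun y ↦ exp (-f y)).aemeasurable,
    ← lintegral_mul_const _ (by fun_prop)]
  refine setLIntegral_congr_fun measurableSet_Ioi fun t ht ↦ ?_
  have ht : 0 < t := ht
  have hset : {y | t ≤ exp (-f y)} = {y | f y ≤ -log t} := by
    ext y
    simp only [Set.mem_ofPred_eq, ← log_le_iff_le_exp ht]
    exact le_neg
  simp only [hset]
  rcases lt_or_ge (-log t) 0 with h | h
  · have hempty : {y | f y ≤ -log t} = ∅ :=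
      Set.eq_empty_of_forall_notMem fun y hy ↦ (hy.trans_lt h).not_ge (hpos y)
    simp [hempty, ENNReal.ofReal_of_nonpos h.le, hn]
  · have hsmul : {y | f y ≤ -log t} = (-log t) • {y | f y ≤ 1} := by
      ext y
      rw [Set.mem_smul_set]
      constructor
      · intro hy
        rcases h.eq_or_lt with h0 | h0
        · have hy : f y ≤ -log t := hy
          have := hzero y (le_antisymm (hy.trans h0.ge) (hpos y))
          refine ⟨0, ?_, by simp [this]⟩
          have := hhom 0 le_rfl 0
          simp only [zero_smul, zero_mul] at this
          simp [this]
        · refine ⟨(-log t)⁻¹ • y, ?_, smul_inv_smul₀ h0.ne' y⟩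
          rw [Set.mem_ofPred_eq, hhom _ (inv_nonneg.2 h)]
          exact inv_mul_le_one_of_le₀ hy h
      · rintro ⟨z, hz, rfl⟩
        rw [Set.mem_ofPred_eq, hhom _ h]
        exact mul_le_of_le_one_right h hz
    rw [hsmul, Measure.addHaar_smul, finrank_euclideanSpace_fin, abs_of_nonneg (pow_nonneg h n),
      ENNReal.ofReal_pow h]

lemma integrable_exp_neg_mul_norm {n : ℕ} (hn : n ≠ 0) {r : ℝ} (hr : 0 < r) :
    Integrable fun y : EuclideanSpace ℝ (Fin n) ↦ exp (-(r * ‖y‖)) := by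
  have : NeZero n := ⟨hn⟩
  have : Nontrivial (EuclideanSpace ℝ (Fin n)) :=
    Module.nontrivial_of_finrank_pos (R := ℝ) (by simpa using Nat.pos_of_ne_zero hn)
  refine (integrable_fun_norm_addHaar volume (f := fun t ↦ exp (-(r * t)))).2 ?_
  refine (integrableOn_rpow_mul_exp_neg_mul_rpow (s := ((n - 1 : ℕ) : ℝ)) (p := 1)
    (by linarith [Nat.cast_nonneg (α := ℝ) (n - 1)]) one_pos hr).congr_fun (fun t _ ↦ ?_)
    measurableSet_Ioi
  simp

/-- There is a dimensional constant relating `∫ exp (-f)` to the volume of `{f ≤ 1}`, for all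
coercive continuous positively homogeneous `f`. -/
lemma exists_integral_exp_neg_eq_mul_volume {n : ℕ} (hn : n ≠ 0) :
    ∃ C : ℝ, 0 < C ∧ ∀ (f : EuclideanSpace ℝ (Fin n) → ℝ) (r : ℝ), Continuous f → 0 < r →
      (∀ y, r * ‖y‖ ≤ f y) → (∀ c : ℝ, 0 ≤ c → ∀ y, f (c • y) = c * f y) →
      ∫ y, exp (-f y) = C * volume.real {y | f y ≤ 1} := by
  set C := ∫⁻ t in Set.Ioi (0 : ℝ), ENNReal.ofReal (-log t) ^ n with hC
  have hC_top : C ≠ ⊤ := by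
    have h := lintegral_exp_neg_eq_mul_volume hn (f := fun y ↦ ‖y‖) continuous_norm
      norm_nonneg (fun y ↦ norm_eq_zero.1) (fun c hc y ↦ by simp [norm_smul, abs_of_nonneg hc])
    have hfin := (integrable_exp_neg_mul_norm hn one_pos).lintegral_lt_top
    simp only [one_mul] at hfin
    have hball : volume {y : EuclideanSpace ℝ (Fin n) | ‖y‖ ≤ 1} ≠ 0 := by
      have := (Metric.measure_closedBall_pos volume (0 : EuclideanSpace ℝ (Fin n)) one_pos).ne'
      simpa [Metric.closedBall] using this
    intro htop
    rw [h, ← hC, htop, ENNReal.top_mul hball] at hfin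
    exact hfin.ne rfl
  have hC_zero : C ≠ 0 := by
    have h : 0 < ∫⁻ t in Set.Ioo (0 : ℝ) 1, ENNReal.ofReal (-log t) ^ n := by
      rw [setLIntegral_pos_iff (by fun_prop)]
      refine lt_of_lt_of_le ?_ (measure_mono (s := Set.Ioo (0 : ℝ) 1) fun t ht ↦ ⟨?_, ht⟩)
      · simp
      · simp [hn, log_neg ht.1 ht.2]
    exact (h.trans_le (lintegral_mono_set Set.Ioo_subset_Ioi_self)).ne'
  refine ⟨C.toReal, ENNReal.toReal_pos hC_zero hC_top, fun f r hf hr hle hhom ↦ ?_⟩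
  rw [integral_eq_lintegral_of_nonneg_ae (.of_forall fun _ ↦ (exp_pos _).le)
    (by fun_prop : Continuous fun y ↦ exp (-f y)).aestronglyMeasurable,
    lintegral_exp_neg_eq_mul_volume hn hf
      (fun y ↦ (mul_nonneg hr.le (norm_nonneg y)).trans (hle y)) (fun y hy ↦ ?_) hhom,
    ENNReal.toReal_mul]
  · rfl
  · have := hle y
    rw [hy] at this
    exact norm_le_zero_iff.1 (nonpos_of_mul_nonpos_right this hr)

lemma exp_midpoint_le (a b : ℝ) : exp (-((a + b) / 2)) ≤ (exp (-a) + exp (-b)) / 2 := by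
  have h := convexOn_exp.2 (Set.mem_univ (-a)) (Set.mem_univ (-b))
    (by norm_num : (0 : ℝ) ≤ 1 / 2) (by norm_num : (0 : ℝ) ≤ 1 / 2) (by norm_num)
  simp only [smul_eq_mul] at h
  have hmid : 1 / 2 * -a + 1 / 2 * -b = -((a + b) / 2) := by ring
  rw [hmid] at h
  linarith

lemma eq_of_exp_midpoint_eq {a b : ℝ}
    (h : exp (-((a + b) / 2)) = (exp (-a) + exp (-b)) / 2) : a = b := by
  by_contra hab
  have h' := strictConvexOn_exp.2 (Set.mem_univ (-a)) (Set.mem_univ (-b))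
    (fun h ↦ hab (neg_injective h))
    (by norm_num : (0 : ℝ) < 1 / 2) (by norm_num : (0 : ℝ) < 1 / 2) (by norm_num)
  simp only [smul_eq_mul] at h'
  have hmid : 1 / 2 * -a + 1 / 2 * -b = -((a + b) / 2) := by ring
  rw [hmid] at h'
  linarith

/-- Symmetrizing a coercive positively homogeneous function does not increase the volume of its
unit sublevel set, and preserves it only if the function is even. -/
lemma volume_symmetrized_sublevel {n : ℕ} (hn : n ≠ 0) {h : EuclideanSpace ℝ (Fin n) → ℝ} {r : ℝ}
    (hcont : Continuous h) (hr : 0 < r) (hle : ∀ y, r * ‖y‖ ≤ h y)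
    (hhom : ∀ c : ℝ, 0 ≤ c → ∀ y, h (c • y) = c * h y) :
    volume.real {y | (h y + h (-y)) / 2 ≤ 1} ≤ volume.real {y | h y ≤ 1} ∧
      (volume.real {y | (h y + h (-y)) / 2 ≤ 1} = volume.real {y | h y ≤ 1} ↔
        ∀ y, h y = h (-y)) := by
  obtain ⟨C, hC, hvol⟩ := exists_integral_exp_neg_eq_mul_volume hn
  have hle' : ∀ y, r * ‖y‖ ≤ (h y + h (-y)) / 2 := fun y ↦ by
    have h1 := hle y
    have h2 := hle (-y)
    rw [norm_neg] at h2
    linarith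
  have hI := hvol h r hcont hr hle hhom
  have hJ := hvol (fun y ↦ (h y + h (-y)) / 2) r (by fun_prop) hr hle' fun c hc y ↦ by
    simp only [← smul_neg, hhom c hc]
    ring
  have integrable_of_le : ∀ g : EuclideanSpace ℝ (Fin n) → ℝ, Continuous g →
      (∀ y, r * ‖y‖ ≤ g y) → Integrable fun y ↦ exp (-g y) := fun g hg hrg ↦
    (integrable_exp_neg_mul_norm hn hr).mono' (by fun_prop : Continuous _).aestronglyMeasurable
      (.of_forall fun y ↦ by simpa using hrg y)
  have hint := integrable_of_le h hcont hle
  have hint_neg : Integrable fun y ↦ exp (-h (-y)) := hint.comp_neg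
  have hint_symm := integrable_of_le (fun y ↦ (h y + h (-y)) / 2) (by fun_prop) hle'
  have hint_avg : Integrable fun y ↦ (exp (-h y) + exp (-h (-y))) / 2 :=
    (hint.add hint_neg).div_const 2
  have havg : ∫ y, (exp (-h y) + exp (-h (-y))) / 2 = ∫ y, exp (-h y) := by
    rw [integral_div, integral_add hint hint_neg,
      integral_neg_eq_self (fun y ↦ exp (-h y)) volume]
    ring
  have hmono := integral_mono hint_symm hint_avg fun y ↦ exp_midpoint_le (h y) (h (-y))
  refine ⟨?_, fun heq ↦ ?_, fun heven ↦ ?_⟩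
  · rw [havg, hI, hJ] at hmono
    exact le_of_mul_le_mul_left hmono hC
  · have hae := (integral_eq_iff_of_ae_le hint_symm hint_avg
      (.of_forall fun y ↦ exp_midpoint_le (h y) (h (-y)))).1 (by rw [havg, hI, hJ, heq])
    have hfun := Continuous.ae_eq_iff_eq (μ := volume) (by fun_prop) (by fun_prop) |>.1 hae
    exact fun y ↦ eq_of_exp_midpoint_eq (congrFun hfun y)
  · congr 1
    ext y
    simp [← heven y]

/-- The support function of `K`. -/
noncomputable def supportFun {n : ℕ} (K : Set (EuclideanSpace ℝ (Fin n)))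
    (y : EuclideanSpace ℝ (Fin n)) : ℝ :=
  sSup ((fun x ↦ ⟪x, y⟫) '' K)

section supportFun

variable {n : ℕ} {K : Set (EuclideanSpace ℝ (Fin n))}

lemma continuous_supportFun (hK : IsCompact K) : Continuous (supportFun K) :=
  hK.continuous_sSup (f := fun y x ↦ ⟪x, y⟫) (by fun_prop)

lemma isLUB_supportFun (hK : IsCompact K) (hne : K.Nonempty) (y : EuclideanSpace ℝ (Fin n)) :
    IsLUB ((fun x ↦ ⟪x, y⟫) '' K) (supportFun K y) :=
  isLUB_csSup (hne.image _) (hK.image (by fun_prop)).bddAbove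

lemma inner_le_supportFun (hK : IsCompact K) {x : EuclideanSpace ℝ (Fin n)} (hx : x ∈ K)
    (y : EuclideanSpace ℝ (Fin n)) : ⟪x, y⟫ ≤ supportFun K y :=
  (isLUB_supportFun hK ⟨x, hx⟩ y).1 ⟨x, hx, rfl⟩

lemma supportFun_le_iff (hK : IsCompact K) (hne : K.Nonempty) {y : EuclideanSpace ℝ (Fin n)}
    {a : ℝ} : supportFun K y ≤ a ↔ ∀ x ∈ K, ⟪x, y⟫ ≤ a := by
  rw [isLUB_le_iff (isLUB_supportFun hK hne y)]
  simp [upperBounds]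

lemma supportFun_smul (c : ℝ) (hc : 0 ≤ c) (y : EuclideanSpace ℝ (Fin n)) :
    supportFun K (c • y) = c * supportFun K y := by
  simp only [supportFun, inner_smul_right]
  rw [← smul_eq_mul, ← Real.sSup_smul_of_nonneg hc, ← Set.image_smul, Set.image_image]
  rfl

lemma mul_norm_le_supportFun (hK : IsCompact K) {r : ℝ} (hr : 0 ≤ r)
    (hball : Metric.closedBall 0 r ⊆ K) (y : EuclideanSpace ℝ (Fin n)) :
    r * ‖y‖ ≤ supportFun K y := by
  have hmem : (r * ‖y‖⁻¹) • y ∈ K := hball <| by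
    rw [mem_closedBall_zero_iff, norm_smul, norm_mul, norm_inv, norm_norm, Real.norm_of_nonneg hr,
      mul_assoc]
    exact mul_le_of_le_one_right hr (inv_mul_le_one)
  refine le_of_eq_of_le ?_ (inner_le_supportFun hK hmem y)
  rw [real_inner_smul_left, real_inner_self_eq_norm_sq]
  rcases eq_or_ne ‖y‖ 0 with h | h
  · simp [h]
  · field_simp

lemma polarBody_eq_setOf_supportFun_le (hK : IsCompact K) (hne : K.Nonempty) :
    polarBody K = {y | supportFun K y ≤ 1} := by
  ext y
  exact (supportFun_le_iff hK hne).symm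

lemma isCompact_sub_self (hK : IsCompact K) : IsCompact (K - K) :=
  sub_eq_add_neg K K ▸ hK.add hK.neg

lemma supportFun_sub_self (hK : IsCompact K) (hne : K.Nonempty) (y : EuclideanSpace ℝ (Fin n)) :
    supportFun (K - K) y = supportFun K y + supportFun K (-y) := by
  refine le_antisymm ((supportFun_le_iff (isCompact_sub_self hK) (hne.sub hne)).2 ?_) ?_
  · rintro _ ⟨a, ha, b, hb, rfl⟩
    have h1 := inner_le_supportFun hK ha y
    have h2 := inner_le_supportFun hK hb (-y)
    rw [inner_neg_right] at h2
    rw [inner_sub_left]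
    linarith
  · rw [← le_sub_iff_add_le, supportFun_le_iff hK hne]
    intro a ha
    rw [le_sub_comm, supportFun_le_iff hK hne]
    intro b hb
    have h := inner_le_supportFun (isCompact_sub_self hK) (Set.sub_mem_sub ha hb) y
    rw [inner_sub_left] at h
    rw [inner_neg_right]
    linarith

lemma eq_neg_of_supportFun_even (hK : IsCompact K) (hconv : Convex ℝ K)
    (heven : ∀ y, supportFun K y = supportFun K (-y)) : K = -K := by
  have hneg : ∀ x ∈ K, -x ∈ K := by
    intro x hx
    by_contra hnot
    obtain ⟨f, u, hlt, hu⟩ := geometric_hahn_banach_closed_point hconv hK.isClosed hnot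
    set y := (InnerProductSpace.toDual ℝ (EuclideanSpace ℝ (Fin n))).symm f
    have hf : ∀ z, f z = ⟪z, y⟫ := fun z ↦ by
      rw [real_inner_comm, InnerProductSpace.toDual_symm_apply]
    have h1 : supportFun K y ≤ u :=
      (supportFun_le_iff hK ⟨x, hx⟩).2 fun z hz ↦ hf z ▸ (hlt z hz).le
    have h2 := inner_le_supportFun hK hx (-y)
    rw [← heven, inner_neg_right] at h2
    rw [hf, inner_neg_left] at hu
    linarith
  ext x
  exact ⟨fun hx ↦ hneg x hx, fun hx ↦ by simpa using hneg _ hx⟩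

lemma supportFun_even_iff (hK : IsCompact K) (hconv : Convex ℝ K) :
    (∀ y, supportFun K y = supportFun K (-y)) ↔ K = -K := by
  refine ⟨eq_neg_of_supportFun_even hK hconv, fun hsymm y ↦ ?_⟩
  conv_lhs => rw [hsymm]
  simp only [supportFun, ← Set.image_neg_eq_neg, Set.image_image, inner_neg_left, inner_neg_right]

end supportFun

/-- For a compact convex `K ⊆ ℝⁿ` with the origin in its interior,
`vol((K − K)°) ≤ 2^{−n}·vol(K°)`, with equality iff `K = −K`. -/
theorem polar_difference_body_volume (n : ℕ) (hn : 1 ≤ n)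
    (K : Set (EuclideanSpace ℝ (Fin n)))
    (hKcomp : IsCompact K) (hKconv : Convex ℝ K)
    (hKint : (0 : EuclideanSpace ℝ (Fin n)) ∈ interior K) :
    (volume (polarBody (K - K))).toReal ≤
      (2 : ℝ) ^ (-(n : ℤ)) * (volume (polarBody K)).toReal ∧
    ((volume (polarBody (K - K))).toReal =
      (2 : ℝ) ^ (-(n : ℤ)) * (volume (polarBody K)).toReal ↔ K = -K) := by
  have hn0 : n ≠ 0 := Nat.one_le_iff_ne_zero.1 hn
  have hne : K.Nonempty := ⟨0, interior_subset hKint⟩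
  obtain ⟨r, hr, hball⟩ := Metric.nhds_basis_closedBall.mem_iff.1 (mem_interior_iff_mem_nhds.1 hKint)
  have hscale : polarBody (K - K) =
      (2 : ℝ)⁻¹ • {y | (supportFun K y + supportFun K (-y)) / 2 ≤ 1} := by
    rw [polarBody_eq_setOf_supportFun_le (isCompact_sub_self hKcomp) (hne.sub hne)]
    ext y
    rw [Set.mem_inv_smul_set_iff₀ two_ne_zero, Set.mem_ofPred_eq, Set.mem_ofPred_eq,
      supportFun_sub_self hKcomp hne, ← smul_neg, supportFun_smul 2 zero_le_two,
      supportFun_smul 2 zero_le_two, ← mul_add, mul_div_cancel_left₀ _ two_ne_zero]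
  have hvol : (volume (polarBody (K - K))).toReal = (2 : ℝ) ^ (-(n : ℤ)) *
      volume.real {y | (supportFun K y + supportFun K (-y)) / 2 ≤ 1} := by
    rw [hscale, Measure.addHaar_smul, ENNReal.toReal_mul, finrank_euclideanSpace_fin,
      ENNReal.toReal_ofReal (abs_nonneg _), abs_of_nonneg (by positivity), inv_pow, zpow_neg,
      zpow_natCast]
    rfl
  have htwo : (0 : ℝ) < 2 ^ (-(n : ℤ)) := by positivity
  obtain ⟨hmain, hiff⟩ := volume_symmetrized_sublevel hn0 (continuous_supportFun hKcomp) hr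
    (mul_norm_le_supportFun hKcomp hr.le hball) supportFun_smul
  rw [hvol, polarBody_eq_setOf_supportFun_le hKcomp hne, mul_right_inj' htwo.ne',
    ← supportFun_even_iff hKcomp hKconv]
  exact ⟨mul_le_mul_of_nonneg_left hmain htwo.le, hiff⟩
end

section
/- Let n ≥ 1 and let K ⊆ ℝ^n be a symmetric convex body. Suppose x, y : ℝ → ℝ^n are differentiable at t₀ and satisfy x(t) ∈ K, y(t) ∈ K° for all t. If ⟨x(t), y(t)⟩ = 1 for all t, then ⟨x'(t₀), y'(t₀)⟩ ≥ 0; if instead ⟨x(t), y(t)⟩ = −1 for all t, then ⟨x'(t₀), y'(t₀)⟩ ≤ 0. (That is, tangent vectors to K⁺ are spacelike and tangent vectors to K⁻ are timelike, with respect to the signature-(n,n) inner product ((x₁,y₁),(x₂,y₂)) = (⟨x₁,y₂⟩ + ⟨x₂,y₁⟩)/2 on ℝ^n × ℝ^n, under which ((x',y'),(x',y')) = ⟨x',y'⟩.) -/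
open Real
open scoped RealInnerProductSpace

/-- If the increments of two curves from their values at `t₀` always have nonnegative inner
product, then so do their derivatives at `t₀`. -/
theorem HasDerivAt.inner_nonneg_of_inner_sub_nonneg {E : Type*} [NormedAddCommGroup E]
    [InnerProductSpace ℝ E] {x y : ℝ → E} {x' y' : E} {t₀ : ℝ}
    (hx : HasDerivAt x x' t₀) (hy : HasDerivAt y y' t₀)
    (h : ∀ t, 0 ≤ ⟪x t - x t₀, y t - y t₀⟫) : 0 ≤ ⟪x', y'⟫ := by
  have hlim := (hasDerivAt_iff_tendsto_slope.mp hx).inner (𝕜 := ℝ)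
    (hasDerivAt_iff_tendsto_slope.mp hy)
  refine ge_of_tendsto' hlim fun t => ?_
  rw [slope_def_module, slope_def_module, real_inner_smul_left, real_inner_smul_right,
    ← mul_assoc]
  exact mul_nonneg (mul_self_nonneg _) (h t)

/-- Curves in `K` and in its polar body whose pairing is constantly `1` have velocities with
nonnegative inner product. -/
theorem inner_deriv_nonneg_of_inner_eq_one {n : ℕ} {K : Set (EuclideanSpace ℝ (Fin n))}
    {x y : ℝ → EuclideanSpace ℝ (Fin n)} {x' y' : EuclideanSpace ℝ (Fin n)} {t₀ : ℝ}
    (hx : HasDerivAt x x' t₀) (hy : HasDerivAt y y' t₀)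
    (hxK : ∀ t, x t ∈ K) (hyK : ∀ t, y t ∈ polarBody K)
    (h : ∀ t, ⟪x t, y t⟫ = (1 : ℝ)) : 0 ≤ ⟪x', y'⟫ := by
  refine hx.inner_nonneg_of_inner_sub_nonneg hy fun t => ?_
  rw [inner_sub_left, inner_sub_right, inner_sub_right, h t, h t₀]
  linarith [hyK t₀ (x t) (hxK t), hyK t (x t₀) (hxK t₀)]

/-- Tangent vectors to `K⁺` are spacelike and tangent vectors to `K⁻` are
timelike: if `x(t) ∈ K`, `y(t) ∈ K°` with `⟨x(t), y(t)⟩ ≡ 1` then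
`⟨x'(t₀), y'(t₀)⟩ ≥ 0`, while if `⟨x(t), y(t)⟩ ≡ −1` then
`⟨x'(t₀), y'(t₀)⟩ ≤ 0`. -/
theorem neck_tangent_causality (n : ℕ) (hn : 1 ≤ n)
    (K : Set (EuclideanSpace ℝ (Fin n)))
    (hKcomp : IsCompact K) (hKconv : Convex ℝ K)
    (hKint : (interior K).Nonempty) (hKsymm : K = -K)
    (x y : ℝ → EuclideanSpace ℝ (Fin n)) (x' y' : EuclideanSpace ℝ (Fin n))
    (t₀ : ℝ) (hx : HasDerivAt x x' t₀) (hy : HasDerivAt y y' t₀)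
    (hxK : ∀ t, x t ∈ K) (hyK : ∀ t, y t ∈ polarBody K) :
    ((∀ t, ⟪x t, y t⟫ = (1 : ℝ)) → ⟪x', y'⟫ ≥ 0) ∧
    ((∀ t, ⟪x t, y t⟫ = (-1 : ℝ)) → ⟪x', y'⟫ ≤ 0) := by
  refine ⟨inner_deriv_nonneg_of_inner_eq_one hx hy hxK hyK, fun h => ?_⟩
  have hnegK : ∀ t, (-x) t ∈ K := fun t => by
    rw [hKsymm]
    simpa using hxK t
  have hneg := inner_deriv_nonneg_of_inner_eq_one hx.neg hy hnegK hyK fun t => by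
    rw [Pi.neg_apply, inner_neg_left, h t, neg_neg]
  rw [inner_neg_left] at hneg
  linarith
end

section
/- Define γ_n = 2^n (n!)^3 / ((2n)! · Γ(n/2+1)^2) for integers n ≥ 1. Then γ_1 = 4/π, the sequence (γ_n) is monotone increasing, and γ_n → √2 as n → ∞; in particular 4/π ≤ γ_n for all n ≥ 1. -/
open Real Filter

/-- Midpoint log-convexity of the Gamma function, with step `1/2`. -/
theorem sq_Gamma_add_half_le {x : ℝ} (hx : 0 < x) :
    Gamma (x + 1 / 2) ^ 2 ≤ x * Gamma x ^ 2 := by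
  have h := Gamma_mul_add_mul_le_rpow_Gamma_mul_rpow_Gamma (s := x) (t := x + 1) (a := 1 / 2)
    (b := 1 / 2) hx (by linarith) (by norm_num) (by norm_num) (by norm_num)
  rw [show (1 / 2 : ℝ) * x + 1 / 2 * (x + 1) = x + 1 / 2 by ring, ← sqrt_eq_rpow,
    ← sqrt_eq_rpow] at h
  have hpos := Gamma_pos_of_pos hx
  have hpos' := Gamma_pos_of_pos (show 0 < x + 1 by linarith)
  calc Gamma (x + 1 / 2) ^ 2 ≤ (√(Gamma x) * √(Gamma (x + 1))) ^ 2 :=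
        pow_le_pow_left₀ (Gamma_pos_of_pos (by linarith)).le h 2
    _ = x * Gamma x ^ 2 := by
        rw [mul_pow, sq_sqrt hpos.le, sq_sqrt hpos'.le, Gamma_add_one hx.ne']
        ring

/-- The value `Γ(n/2+1)`, an interpolation of the factorial at half-integers. -/
noncomputable def halfGamma (n : ℕ) : ℝ := Gamma ((n : ℝ) / 2 + 1)

theorem halfGamma_pos (n : ℕ) : 0 < halfGamma n := Gamma_pos_of_pos (by positivity)

theorem halfGamma_add_two (n : ℕ) : halfGamma (n + 2) = ((n : ℝ) / 2 + 1) * halfGamma n := by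
  rw [halfGamma, halfGamma, ← Gamma_add_one (by positivity)]
  push_cast
  ring_nf

theorem sq_halfGamma_succ_le (n : ℕ) :
    halfGamma (n + 1) ^ 2 ≤ ((n : ℝ) / 2 + 1) * halfGamma n ^ 2 := by
  have h := sq_Gamma_add_half_le (show (0 : ℝ) < (n : ℝ) / 2 + 1 by positivity)
  rw [show (n : ℝ) / 2 + 1 + 1 / 2 = ((n + 1 : ℕ) : ℝ) / 2 + 1 by push_cast; ring] at h
  exact h

theorem halfGamma_mul_succ (n : ℕ) :
    halfGamma n * halfGamma (n + 1) = (n + 1).factorial * √π / 2 ^ (n + 1) := by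
  have h := Gamma_mul_Gamma_add_half_of_pos (show (0 : ℝ) < (n : ℝ) / 2 + 1 by positivity)
  rw [show (n : ℝ) / 2 + 1 + 1 / 2 = ((n + 1 : ℕ) : ℝ) / 2 + 1 by push_cast; ring,
    show 2 * ((n : ℝ) / 2 + 1) = ((n + 1 : ℕ) : ℝ) + 1 by push_cast; ring,
    Gamma_nat_eq_factorial, show (1 : ℝ) - (((n + 1 : ℕ) : ℝ) + 1) = -((n + 1 : ℕ) : ℝ) by ring,
    rpow_neg (by norm_num), rpow_natCast] at h
  rw [halfGamma, halfGamma, h]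
  ring

/-- The factor `γₙ = 2^n (n!)³ / ((2n)! Γ(n/2+1)²)`. -/
noncomputable def gammaFactor (n : ℕ) : ℝ :=
  2 ^ n * (n.factorial : ℝ) ^ 3 / (((2 * n).factorial : ℝ) * halfGamma n ^ 2)

/-- The quotient `γₙ₊₁ / γₙ`. -/
noncomputable def gammaFactorRatio (n : ℕ) : ℝ :=
  ((n : ℝ) + 1) ^ 2 / (2 * n + 1) * (halfGamma n / halfGamma (n + 1)) ^ 2

theorem gammaFactor_pos (n : ℕ) : 0 < gammaFactor n := by
  have := halfGamma_pos n
  unfold gammaFactor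
  positivity

theorem gammaFactor_succ (n : ℕ) :
    gammaFactor (n + 1) = gammaFactorRatio n * gammaFactor n := by
  have h0 := (halfGamma_pos n).ne'
  have h1 := (halfGamma_pos (n + 1)).ne'
  have h2 : ((2 * n).factorial : ℝ) ≠ 0 := by positivity
  unfold gammaFactor gammaFactorRatio
  rw [show 2 * (n + 1) = 2 * n + 1 + 1 by ring]
  simp only [Nat.factorial_succ]
  push_cast
  field_simp
  ring

theorem gammaFactorRatio_add_two_le (n : ℕ) :
    gammaFactorRatio (n + 2) ≤ gammaFactorRatio n := by
  have h1 := (halfGamma_pos (n + 1)).ne'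
  have key : gammaFactorRatio (n + 2) =
      ((n : ℝ) + 2) ^ 2 / (2 * n + 5) * (halfGamma n / halfGamma (n + 1)) ^ 2 := by
    rw [gammaFactorRatio, show n + 2 + 1 = n + 1 + 2 by ring, halfGamma_add_two,
      halfGamma_add_two]
    have h3 : (n : ℝ) + 3 ≠ 0 := by positivity
    have h4 : (n : ℝ) + 1 + 2 ≠ 0 := by positivity
    push_cast
    field_simp
    ring
  rw [key, gammaFactorRatio]
  gcongr ?_ * _
  rw [div_le_div_iff₀ (by positivity) (by positivity)]
  nlinarith

theorem le_gammaFactorRatio (n : ℕ) : 1 - 1 / ((n : ℝ) + 1) ≤ gammaFactorRatio n := by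
  have h0 := halfGamma_pos n
  have h1 := halfGamma_pos (n + 1)
  have h : 1 / ((n : ℝ) / 2 + 1) ≤ (halfGamma n / halfGamma (n + 1)) ^ 2 := by
    rw [div_pow, div_le_div_iff₀ (by positivity) (by positivity)]
    linarith [sq_halfGamma_succ_le n]
  calc 1 - 1 / ((n : ℝ) + 1) ≤ ((n : ℝ) + 1) ^ 2 / (2 * n + 1) * (1 / ((n : ℝ) / 2 + 1)) := by
        rw [← sub_nonneg]
        have : ((n : ℝ) + 1) ^ 2 / (2 * n + 1) * (1 / ((n : ℝ) / 2 + 1)) - (1 - 1 / ((n : ℝ) + 1))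
            = (n ^ 2 + 4 * n + 2) / ((2 * n + 1) * (n + 2) * (n + 1)) := by
          field_simp
          ring
        rw [this]
        positivity
    _ ≤ gammaFactorRatio n := by
        unfold gammaFactorRatio
        gcongr

theorem gammaFactorRatio_le (n : ℕ) : gammaFactorRatio n ≤ 1 + 1 / ((n : ℝ) + 1) := by
  have h0 := halfGamma_pos n
  have h1 := halfGamma_pos (n + 1)
  have h : (halfGamma n / halfGamma (n + 1)) ^ 2 ≤ ((n : ℝ) / 2 + 3 / 2) / ((n : ℝ) / 2 + 1) ^ 2 := by
    have h2 := sq_halfGamma_succ_le (n + 1)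
    rw [show n + 1 + 1 = n + 2 by ring, halfGamma_add_two] at h2
    push_cast at h2
    rw [div_pow, div_le_div_iff₀ (by positivity) (by positivity)]
    linarith
  calc gammaFactorRatio n
      ≤ ((n : ℝ) + 1) ^ 2 / (2 * n + 1) * (((n : ℝ) / 2 + 3 / 2) / ((n : ℝ) / 2 + 1) ^ 2) := by
        unfold gammaFactorRatio
        gcongr
    _ ≤ 1 + 1 / ((n : ℝ) + 1) := by
        rw [← sub_nonneg]
        have : 1 + 1 / ((n : ℝ) + 1) -
            ((n : ℝ) + 1) ^ 2 / (2 * n + 1) * (((n : ℝ) / 2 + 3 / 2) / ((n : ℝ) / 2 + 1) ^ 2)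
            = (n ^ 3 + 6 * n ^ 2 + 8 * n + 2) / ((2 * n + 1) * (n + 2) ^ 2 * (n + 1)) := by
          field_simp
          ring
        rw [this]
        positivity

theorem tendsto_gammaFactorRatio : Tendsto gammaFactorRatio atTop (nhds 1) := by
  have h := tendsto_one_div_add_atTop_nhds_zero_nat (𝕜 := ℝ)
  refine tendsto_of_tendsto_of_tendsto_of_le_of_le ?_ ?_ le_gammaFactorRatio gammaFactorRatio_le
  · simpa using h.const_sub 1
  · simpa using h.const_add 1

theorem one_le_gammaFactorRatio (n : ℕ) : 1 ≤ gammaFactorRatio n := by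
  have hanti : Antitone fun k : ℕ => gammaFactorRatio (n + 2 * k) :=
    antitone_nat_of_succ_le fun k => gammaFactorRatio_add_two_le (n + 2 * k)
  have hlim : Tendsto (fun k : ℕ => gammaFactorRatio (n + 2 * k)) atTop (nhds 1) :=
    tendsto_gammaFactorRatio.comp
      (tendsto_atTop_mono (fun k => show k ≤ n + 2 * k by omega) tendsto_id)
  exact hanti.le_of_tendsto hlim 0

theorem gammaFactor_monotone : Monotone gammaFactor :=
  monotone_nat_of_le_succ fun n => by
    rw [gammaFactor_succ]
    exact le_mul_of_one_le_left (gammaFactor_pos n).le (one_le_gammaFactorRatio n)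

theorem gammaFactor_mul_succ (n : ℕ) :
    gammaFactor n * gammaFactor (n + 1) = 4 / π * Wallis.W n := by
  have h0 := halfGamma_pos n
  have h1 := halfGamma_pos (n + 1)
  have hprod : gammaFactor n * gammaFactor (n + 1) =
      2 ^ n * (n.factorial : ℝ) ^ 3 * (2 ^ (n + 1) * ((n + 1).factorial : ℝ) ^ 3) /
        ((2 * n).factorial * (2 * (n + 1)).factorial * (halfGamma n * halfGamma (n + 1)) ^ 2) := by
    unfold gammaFactor
    field_simp
  have h2 : ((2 * n).factorial : ℝ) ≠ 0 := by positivity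
  have h3 : (n.factorial : ℝ) ≠ 0 := by positivity
  rw [hprod, halfGamma_mul_succ, Wallis.W_eq_factorial_ratio, div_pow, mul_pow, sq_sqrt pi_pos.le,
    show 2 * (n + 1) = 2 * n + 1 + 1 by ring]
  simp only [Nat.factorial_succ]
  push_cast
  field_simp
  ring

theorem tendsto_gammaFactor : Tendsto gammaFactor atTop (nhds √2) := by
  have h : Tendsto (fun n => √(4 / π * Wallis.W n / gammaFactorRatio n)) atTop (nhds √2) := by
    have h2 := (((Wallis.tendsto_W_nhds_pi_div_two.const_mul (4 / π)).div
      tendsto_gammaFactorRatio one_ne_zero).sqrt)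
    rwa [show 4 / π * (π / 2) / 1 = 2 by field_simp; norm_num] at h2
  refine h.congr fun n => ?_
  have hq := (zero_lt_one.trans_le (one_le_gammaFactorRatio n)).ne'
  rw [← gammaFactor_mul_succ, gammaFactor_succ,
    show gammaFactor n * (gammaFactorRatio n * gammaFactor n) / gammaFactorRatio n =
      gammaFactor n ^ 2 by field_simp, sqrt_sq (gammaFactor_pos n).le]

theorem gammaFactor_one : gammaFactor 1 = 4 / π := by
  have h : halfGamma 1 = √π / 2 := by simpa [halfGamma] using halfGamma_mul_succ 0
  rw [gammaFactor, h, div_pow, sq_sqrt pi_pos.le]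
  norm_num [Nat.factorial]
  field_simp

/-- The factor `γₙ = 2^n (n!)³ / ((2n)! Γ(n/2+1)²)` satisfies `γ₁ = 4/π`, is
monotone increasing, converges to `√2`, and in particular `γₙ ≥ 4/π`. -/
theorem gamma_factor_properties :
    (fun n : ℕ => 2 ^ n * (n.factorial : ℝ) ^ 3 /
        (((2 * n).factorial : ℝ) * (Real.Gamma ((n : ℝ) / 2 + 1)) ^ 2)) 1 = 4 / π ∧
    (∀ m n : ℕ, 1 ≤ m → m ≤ n →
      2 ^ m * (m.factorial : ℝ) ^ 3 /
        (((2 * m).factorial : ℝ) * (Real.Gamma ((m : ℝ) / 2 + 1)) ^ 2) ≤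
      2 ^ n * (n.factorial : ℝ) ^ 3 /
        (((2 * n).factorial : ℝ) * (Real.Gamma ((n : ℝ) / 2 + 1)) ^ 2)) ∧
    Tendsto (fun n : ℕ => 2 ^ n * (n.factorial : ℝ) ^ 3 /
        (((2 * n).factorial : ℝ) * (Real.Gamma ((n : ℝ) / 2 + 1)) ^ 2))
      atTop (nhds (Real.sqrt 2)) ∧
    (∀ n : ℕ, 1 ≤ n → 4 / π ≤
      2 ^ n * (n.factorial : ℝ) ^ 3 /
        (((2 * n).factorial : ℝ) * (Real.Gamma ((n : ℝ) / 2 + 1)) ^ 2)) := by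
  exact ⟨gammaFactor_one, fun _ _ _ h => gammaFactor_monotone h, tendsto_gammaFactor,
    fun _ h => gammaFactor_one ▸ gammaFactor_monotone h⟩
end

section
/- Let n ≥ 1 and let Δ ⊆ ℝ^n be an n-dimensional simplex (the convex hull of n+1 affinely independent points) whose centroid is the origin. Then the Mahler volume of Δ is v(Δ) = vol(Δ)·vol(Δ°) = (n+1)^{n+1}/(n!)^2. -/
open MeasureTheory Real
open scoped RealInnerProductSpace

/-- The corner simplex of size `r`: nonnegative vectors with coordinate sum at most `r`. -/
def cornerSimplex (n : ℕ) (r : ℝ) : Set (Fin n → ℝ) :=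
  {x | (∀ i, 0 ≤ x i) ∧ ∑ i, x i ≤ r}

theorem isClosed_cornerSimplex (n : ℕ) (r : ℝ) : IsClosed (cornerSimplex n r) := by
  have h : cornerSimplex n r = (⋂ i, {x | 0 ≤ x i}) ∩ {x | ∑ i, x i ≤ r} := by
    ext x
    simp [cornerSimplex]
  rw [h]
  exact (isClosed_iInter fun i => isClosed_le (by fun_prop) (by fun_prop)).inter
    (isClosed_le (by fun_prop) (by fun_prop))

theorem convex_cornerSimplex (n : ℕ) (r : ℝ) : Convex ℝ (cornerSimplex n r) := by
  rintro x ⟨hx, hxr⟩ y ⟨hy, hyr⟩ a b ha hb hab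
  refine ⟨fun i => ?_, ?_⟩
  · have := hx i
    have := hy i
    simp only [Pi.add_apply, Pi.smul_apply, smul_eq_mul]
    positivity
  · simp only [Pi.add_apply, Pi.smul_apply, smul_eq_mul, Finset.sum_add_distrib,
      ← Finset.mul_sum]
    calc a * ∑ i, x i + b * ∑ i, y i ≤ a * r + b * r := by gcongr
      _ = r := by rw [← add_mul, hab, one_mul]

theorem cornerSimplex_eq_empty (n : ℕ) {r : ℝ} (hr : r < 0) : cornerSimplex n r = ∅ := by
  ext x
  simp only [cornerSimplex, Set.mem_ofPred_eq, Set.mem_empty_iff_false, iff_false, not_and, not_le]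
  exact fun hx => hr.trans_le (Finset.sum_nonneg fun i _ => hx i)

theorem volume_cornerSimplex (n : ℕ) {r : ℝ} (hr : 0 ≤ r) :
    volume (cornerSimplex n r) = ENNReal.ofReal (r ^ n / n.factorial) := by
  induction n generalizing r with
  | zero =>
    have : cornerSimplex 0 r = Set.univ := by
      ext x
      simp [cornerSimplex, hr]
    simp [this, volume_pi]
  | succ n ih =>
    have hp := volume_preserving_piFinSuccAbove (fun _ : Fin (n + 1) => ℝ) 0
    let s : Set (ℝ × (Fin n → ℝ)) := {z | 0 ≤ z.1 ∧ z.2 ∈ cornerSimplex n (r - z.1)}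
    have hs : MeasurableSet s := by
      have h : s = {z | 0 ≤ z.1} ∩ ((⋂ i, {z | 0 ≤ z.2 i}) ∩ {z | ∑ i, z.2 i ≤ r - z.1}) := by
        ext x
        simp [s, cornerSimplex]
      rw [h]
      exact ((isClosed_le (by fun_prop) (by fun_prop)).inter
        ((isClosed_iInter fun i => isClosed_le (by fun_prop) (by fun_prop)).inter
        (isClosed_le (by fun_prop) (by fun_prop)))).measurableSet
    have hpre : cornerSimplex (n + 1) r =
        MeasurableEquiv.piFinSuccAbove (fun _ : Fin (n + 1) => ℝ) 0 ⁻¹' s := by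
      ext x
      simp [s, cornerSimplex, Fin.forall_fin_succ, Fin.sum_univ_succ, Fin.tail, and_assoc,
        le_sub_iff_add_le']
    have hslice : ∀ t : ℝ, volume (Prod.mk t ⁻¹' s) =
        (Set.Icc 0 r).indicator (fun t => ENNReal.ofReal ((r - t) ^ n / n.factorial)) t := by
      intro t
      by_cases h0 : 0 ≤ t
      · have hst : Prod.mk t ⁻¹' s = cornerSimplex n (r - t) := by
          ext x
          simp [s, h0]
        rw [hst]
        by_cases h1 : t ≤ r
        · rw [Set.indicator_of_mem (Set.mem_Icc.2 ⟨h0, h1⟩), ih (sub_nonneg.2 h1)]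
        · rw [Set.indicator_of_notMem (fun h => h1 h.2),
            cornerSimplex_eq_empty n (by linarith), measure_empty]
      · have hst : Prod.mk t ⁻¹' s = ∅ := by
          ext x
          simp [s, h0]
        rw [hst, Set.indicator_of_notMem (fun h => h0 h.1), measure_empty]
    rw [hpre, hp.measure_preimage_equiv, Measure.volume_eq_prod, Measure.prod_apply hs]
    simp_rw [hslice]
    rw [lintegral_indicator measurableSet_Icc, ← ofReal_integral_eq_lintegral_ofReal]
    · congr 1
      rw [integral_Icc_eq_integral_Ioc, ← intervalIntegral.integral_of_le hr,
        intervalIntegral.integral_div,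
        intervalIntegral.integral_comp_sub_left (fun x => x ^ n) r, integral_pow]
      simp [Nat.factorial_succ, field]
    · exact Continuous.integrableOn_Icc (by fun_prop)
    · refine (ae_restrict_iff' measurableSet_Icc).2 (.of_forall fun t ht => ?_)
      have := sub_nonneg.2 ht.2
      simp only [Pi.zero_apply]
      positivity

theorem convexHull_range_eq_image_cornerSimplex {E : Type*} [AddCommGroup E] [Module ℝ E] {n : ℕ}
    (p : Fin (n + 1) → E) :
    convexHull ℝ (Set.range p) =
      (fun w => p 0 + ∑ i, w i • (p i.succ - p 0)) '' cornerSimplex n 1 := by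
  refine Set.Subset.antisymm (convexHull_min ?_ ?_) ?_
  · rintro _ ⟨i, rfl⟩
    refine Fin.cases ⟨0, by simp [cornerSimplex], by simp⟩ (fun j => ⟨Pi.single j 1, ?_, ?_⟩) i
    · refine ⟨fun k => ?_, by simp⟩
      by_cases h : k = j
      · subst h; simp
      · simp [h]
    · simp [Pi.single_apply, ite_smul]
  · have h := ((convex_cornerSimplex n 1).linear_image
      (Fintype.linearCombination ℝ fun i => p i.succ - p 0)).translate (p 0)
    rw [Set.image_image] at h
    exact h
  · rintro _ ⟨w, ⟨hw, hw1⟩, rfl⟩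
    refine mem_convexHull_of_exists_fintype (Fin.cons (1 - ∑ i, w i) w) p ?_ ?_
      (fun i => ⟨i, rfl⟩) ?_
    · exact Fin.cases (by simpa using hw1) (by simpa using hw)
    · simp [Fin.sum_univ_succ]
    · simp only [Fin.sum_univ_succ, Fin.cons_zero, Fin.cons_succ, smul_sub, sub_smul, one_smul,
        Finset.sum_sub_distrib, Finset.sum_smul]
      abel

theorem polarBody_convexHull {n : ℕ} (s : Set (EuclideanSpace ℝ (Fin n))) :
    polarBody (convexHull ℝ s) = polarBody s := by
  refine Set.Subset.antisymm (fun y hy x hx => hy x (subset_convexHull ℝ s hx)) fun y hy => ?_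
  have hc : Convex ℝ {x : EuclideanSpace ℝ (Fin n) | ⟪x, y⟫ ≤ (1 : ℝ)} :=
    convex_halfSpace_le ⟨fun a b => inner_add_left a b y, fun c a => real_inner_smul_left a y c⟩ 1
  exact fun x hx => convexHull_min hy hc hx

theorem sum_eq_zero_of_centroid_eq_zero {n : ℕ} {E : Type*} [AddCommGroup E] [Module ℝ E]
    {p : Fin (n + 1) → E} (h : Finset.univ.centroid ℝ p = 0) : ∑ i, p i = 0 := by
  rw [Finset.centroid_def, Finset.affineCombination_eq_linear_combination _ _ _
    (Finset.sum_centroidWeights_eq_one_of_nonempty ℝ _ Finset.univ_nonempty)] at h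
  simp only [Finset.centroidWeights_apply, ← Finset.smul_sum] at h
  refine (smul_eq_zero.1 h).resolve_left (inv_ne_zero ?_)
  simp only [Finset.card_univ, Fintype.card_fin]
  positivity

section

variable {n : ℕ} (p : Fin (n + 1) → EuclideanSpace ℝ (Fin n))

/-- The matrix whose rows are the edge vectors from the vertex `p 0`. -/
def edgeMatrix : Matrix (Fin n) (Fin n) ℝ := Matrix.of fun i j => p i.succ j - p 0 j

/-- The matrix whose rows are the vertices other than `p 0`. -/
def vertexMatrix : Matrix (Fin n) (Fin n) ℝ := Matrix.of fun i j => p i.succ j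

variable {p}

theorem det_edgeMatrix (h : ∑ i, p i = 0) :
    (edgeMatrix p).det = (n + 1) * (vertexMatrix p).det := by
  have hmul : edgeMatrix p = (1 + Matrix.replicateCol Unit (fun _ : Fin n => (1 : ℝ)) *
      Matrix.replicateRow Unit (fun _ : Fin n => (1 : ℝ))) * vertexMatrix p := by
    ext i j
    have hj := congrArg (fun v : EuclideanSpace ℝ (Fin n) => v j) h
    simp only [Fin.sum_univ_succ, PiLp.add_apply, WithLp.ofLp_sum, Finset.sum_apply,
      PiLp.zero_apply] at hj
    rw [add_mul, one_mul, Matrix.add_apply]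
    simp [edgeMatrix, vertexMatrix, Matrix.mul_apply]
    linarith
  rw [hmul, Matrix.det_mul, Matrix.det_one_add_replicateCol_mul_replicateRow]
  simp [dotProduct, add_comm]

theorem det_edgeMatrix_ne_zero (hp : AffineIndependent ℝ p) : (edgeMatrix p).det ≠ 0 := by
  rw [← isUnit_iff_ne_zero, ← Matrix.isUnit_iff_isUnit_det,
    ← Matrix.linearIndependent_rows_iff_isUnit]
  have h := (affineIndependent_iff_linearIndependent_vsub ℝ p 0).1 hp
  have h' := h.comp (fun i : Fin n => (⟨i.succ, Fin.succ_ne_zero i⟩ : {x : Fin (n + 1) // x ≠ 0}))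
    fun i j hij => by simpa using hij
  exact h'.map' (WithLp.linearEquiv 2 ℝ (Fin n → ℝ)).toLinearMap (LinearEquiv.ker _)

theorem volume_eq_volume_preimage_toLp (s : Set (EuclideanSpace ℝ (Fin n))) :
    volume s = volume (WithLp.toLp 2 ⁻¹' s : Set (Fin n → ℝ)) :=
  ((EuclideanSpace.volume_preserving_symm_measurableEquiv_toLp (Fin n)).symm.measure_preimage_equiv
    s).symm

variable (p) in
theorem volume_convexHull_range : volume (convexHull ℝ (Set.range p)) =
    ENNReal.ofReal |(edgeMatrix p).det| * ENNReal.ofReal (1 / n.factorial) := by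
  have h : (WithLp.toLp 2 ⁻¹' convexHull ℝ (Set.range p) : Set (Fin n → ℝ)) =
      (fun x => WithLp.ofLp (p 0) + x) '' (Matrix.toLin' (edgeMatrix p).transpose ''
        cornerSimplex n 1) := by
    rw [convexHull_range_eq_image_cornerSimplex, Set.image_image]
    ext x
    refine exists_congr fun w => and_congr_right fun _ => ?_
    rw [← (WithLp.ofLp_injective 2).eq_iff]
    refine Eq.congr_left (funext fun j => ?_)
    simp [edgeMatrix, Matrix.mulVec, dotProduct, mul_comm]
  rw [volume_eq_volume_preimage_toLp, h, Set.image_add_left, measure_preimage_add,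
    Measure.addHaar_image_linearMap, LinearMap.det_toLin', Matrix.det_transpose,
    volume_cornerSimplex n zero_le_one, one_pow]

theorem volume_polarBody_range (h : ∑ i, p i = 0) (hdet : (vertexMatrix p).det ≠ 0) :
    volume (polarBody (Set.range p)) = ENNReal.ofReal |(vertexMatrix p).det⁻¹| *
      ENNReal.ofReal ((n + 1) ^ n / n.factorial) := by
  have hpre : (WithLp.toLp 2 ⁻¹' polarBody (Set.range p) : Set (Fin n → ℝ)) =
      Matrix.toLin' (vertexMatrix p) ⁻¹' ((fun v => 1 - v) ⁻¹' cornerSimplex n (n + 1)) := by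
    ext y
    have hin : ∀ i : Fin n, ⟪p i.succ, WithLp.toLp 2 y⟫ = (vertexMatrix p).mulVec y i := by
      intro i
      simp [PiLp.inner_apply, vertexMatrix, Matrix.mulVec, dotProduct, mul_comm]
    have h0 : ⟪p 0, WithLp.toLp 2 y⟫ = -∑ i, (vertexMatrix p).mulVec y i := by
      rw [Fin.sum_univ_succ] at h
      rw [eq_neg_of_add_eq_zero_left h, inner_neg_left, sum_inner]
      simp_rw [hin]
    simp only [polarBody, cornerSimplex, Set.mem_preimage, Set.mem_ofPred_eq, Set.forall_mem_range,
      Fin.forall_fin_succ, hin, h0, Matrix.toLin'_apply, Pi.sub_apply, Pi.one_apply, sub_nonneg,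
      Finset.sum_sub_distrib, Finset.sum_const, Finset.card_univ, Fintype.card_fin, nsmul_eq_mul,
      mul_one]
    rw [and_comm]
    refine and_congr_right fun _ => ?_
    constructor <;> intro <;> linarith
  rw [volume_eq_volume_preimage_toLp, hpre,
    Measure.addHaar_preimage_linearMap _ (by rwa [LinearMap.det_toLin']),
    LinearMap.det_toLin', (Measure.measurePreserving_sub_left volume (1 : Fin n → ℝ)).measure_preimage
      (isClosed_cornerSimplex _ _).nullMeasurableSet, volume_cornerSimplex n (by positivity)]

end

/-- The Mahler volume of a centered `n`-simplex is `(n+1)^{n+1}/(n!)²`. -/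
theorem centered_simplex_mahler_volume (n : ℕ) (hn : 1 ≤ n)
    (p : Fin (n + 1) → EuclideanSpace ℝ (Fin n))
    (hp : AffineIndependent ℝ p)
    (hcent : Finset.univ.centroid ℝ p = 0) :
    (volume (convexHull ℝ (Set.range p))).toReal *
      (volume (polarBody (convexHull ℝ (Set.range p)))).toReal =
      ((n : ℝ) + 1) ^ (n + 1) / ((n.factorial : ℝ)) ^ 2 := by
  have hsum := sum_eq_zero_of_centroid_eq_zero hcent
  have hdet : (vertexMatrix p).det ≠ 0 := by
    have h := det_edgeMatrix_ne_zero hp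
    rw [det_edgeMatrix hsum] at h
    exact right_ne_zero_of_mul h
  rw [polarBody_convexHull, volume_convexHull_range, volume_polarBody_range hsum hdet,
    det_edgeMatrix hsum, ENNReal.toReal_mul, ENNReal.toReal_mul,
    ENNReal.toReal_ofReal (abs_nonneg _), ENNReal.toReal_ofReal (by positivity),
    ENNReal.toReal_ofReal (abs_nonneg _), ENNReal.toReal_ofReal (by positivity),
    abs_mul, abs_inv, abs_of_nonneg (by positivity : (0 : ℝ) ≤ n + 1)]
  have := abs_ne_zero.2 hdet
  field_simp
  rw [pow_succ']
end
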